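/- arXiv:1605.02841 — 5 statements merged into one kernel-verified Lean document; each statement's English description precedes it below -/
import Mathlib

section
/- For every finite field extension L of k = F_q(T) (with L ⊆ k̄), the Carlitz torsion μ(L) is a finite set. -/
open Polynomial IntermediateField

noncomputable section

variable (Fq : Type) [Field Fq] [Fintype Fq]

/-- A fixed algebraic closure of the rational function field `k = Fq(T)`. -/
abbrev Kbar := AlgebraicClosure (RatFunc Fq)

/-- The Carlitz action of `T`: the `Fq`-linear map `u ↦ T•u + u^q`. -/
def carlitzT : Module.End Fq (Kbar Fq) where
  toFun u := algebraMap (RatFunc Fq) (Kbar Fq) RatFunc.X * u + u ^ Fintype.card Fq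
  map_add' u v := by
    obtain ⟨n, hp, hcard⟩ := FiniteField.card Fq (ringChar Fq)
    haveI : Fact (ringChar Fq).Prime := ⟨hp⟩
    haveI : CharP (Kbar Fq) (ringChar Fq) :=
      charP_of_injective_algebraMap (algebraMap Fq (Kbar Fq)).injective _
    show algebraMap (RatFunc Fq) (Kbar Fq) RatFunc.X * (u + v) + (u + v) ^ Fintype.card Fq =
      (algebraMap (RatFunc Fq) (Kbar Fq) RatFunc.X * u + u ^ Fintype.card Fq) +
        (algebraMap (RatFunc Fq) (Kbar Fq) RatFunc.X * v + v ^ Fintype.card Fq)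
    rw [hcard, add_pow_char_pow]
    ring
  map_smul' c u := by
    simp only [RingHom.id_apply, smul_add, mul_smul_comm, _root_.smul_pow, FiniteField.pow_card]

/-- The Carlitz module: the `Fq`-algebra morphism `Fq[T] → End_{Fq}(k̄)`
determined by `T ↦ (u ↦ T·u + u^q)`. -/
def carlitzHom : Polynomial Fq →ₐ[Fq] Module.End Fq (Kbar Fq) :=
  aeval (carlitzT Fq)

/-- The Carlitz action `C_a(u)`. -/
def carlitz (a : Polynomial Fq) (u : Kbar Fq) : Kbar Fq :=
  carlitzHom Fq a u

/-- `Λ_a = {u ∈ k̄ : C_a(u) = 0}`. -/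
def Lambda (a : Polynomial Fq) : Set (Kbar Fq) := {u | carlitz Fq a u = 0}

/-- The Carlitz torsion `μ(L)` of an intermediate field `L`. -/
def carlitzTorsion (L : IntermediateField (RatFunc Fq) (Kbar Fq)) : Set (Kbar Fq) :=
  {u | u ∈ L ∧ ∃ a : Polynomial Fq, a ≠ 0 ∧ carlitz Fq a u = 0}

/-- `DrinT(L/K) = {u ∈ L : C_m(u) ∈ K for some nonzero m}`. -/
def DrinT (K L : IntermediateField (RatFunc Fq) (Kbar Fq)) : Set (Kbar Fq) :=
  {u | u ∈ L ∧ ∃ m : Polynomial Fq, m ≠ 0 ∧ carlitz Fq m u ∈ K}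

/-- `L/K` is radical: `L = K(X)` for some `X ⊆ DrinT(L/K)`. -/
def IsRadicalC (K L : IntermediateField (RatFunc Fq) (Kbar Fq)) : Prop :=
  ∃ X ⊆ DrinT Fq K L, L = adjoin (RatFunc Fq) ((K : Set (Kbar Fq)) ∪ X)

/-- `L/K` is pure: every root in `L` of some `C_m`, `m` irreducible, lies in `K`. -/
def IsPureC (K L : IntermediateField (RatFunc Fq) (Kbar Fq)) : Prop :=
  ∀ m : Polynomial Fq, Irreducible m → ∀ u ∈ L, carlitz Fq m u = 0 → u ∈ K

/-- `L/K` is separable: every element of `L` is separable over `K`. -/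
def IsSeparableC (K L : IntermediateField (RatFunc Fq) (Kbar Fq)) : Prop :=
  ∀ u ∈ L, IsSeparable K u

/-- `L/K` is cyclotomic coradical: radical, separable and pure. -/
def IsCycloCoradicalC (K L : IntermediateField (RatFunc Fq) (Kbar Fq)) : Prop :=
  IsRadicalC Fq K L ∧ IsSeparableC Fq K L ∧ IsPureC Fq K L

section FiniteConstants

variable {Fq}
variable {K : Type*} [Field K] [Algebra Fq K]
variable {Γ : Type*} [LinearOrderedCommGroupWithZero Γ] (v : Valuation K Γ)

/-- A valuation is trivial on a finite field of constants. -/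
theorem valuation_algebraMap_finite_eq_one {c : Fq} (hc : c ≠ 0) : v (algebraMap Fq K c) = 1 := by
  have h : v (algebraMap Fq K c) ^ (Fintype.card Fq - 1) = 1 := by
    rw [← map_pow, ← map_pow, FiniteField.pow_card_sub_one_eq_one c hc, map_one, map_one]
  exact (pow_eq_one_iff_of_nonneg zero_le (Nat.sub_pos_of_lt Fintype.one_lt_card).ne').1 h

/-- A combination of elements of strictly increasing valuation, with coefficients in a finite
field, has the valuation of its leading term. -/
theorem valuation_sum_coeff_smul {f : ℕ → K} (h0 : f 0 ≠ 0) (hf : StrictMono fun i => v (f i))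
    {a : Fq[X]} (ha : a ≠ 0) : v (a.sum fun i c => c • f i) = v (f a.natDegree) := by
  have hsmul (c : Fq) (hc : c ≠ 0) (i : ℕ) : v (c • f i) = v (f i) := by
    rw [Algebra.smul_def, map_mul, valuation_algebraMap_finite_eq_one v hc, one_mul]
  have hpos : 0 < v (f a.natDegree) :=
    (zero_lt_iff.2 (v.ne_zero_iff.2 h0)).trans_le (hf.monotone (Nat.zero_le _))
  have hlead := hsmul a.leadingCoeff (leadingCoeff_ne_zero.2 ha) a.natDegree
  rw [Polynomial.sum_over_range _ (fun i => zero_smul Fq (f i)), Finset.sum_range_succ,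
    coeff_natDegree, ← hlead]
  refine v.map_add_eq_of_lt_right ?_
  rw [hlead]
  refine v.map_sum_lt hpos.ne' fun i hi => ?_
  by_cases hc : a.coeff i = 0
  · rwa [hc, zero_smul, map_zero]
  · rw [hsmul _ hc]
    exact hf (Finset.mem_range.1 hi)

end FiniteConstants

/-- The coefficients of a product of linear factors are bounded by a power of any bound on the
roots. -/
theorem valuation_coeff_prod_X_sub_C_le {K Γ : Type*} [Field K] [LinearOrderedCommGroupWithZero Γ]
    (v : Valuation K Γ) {B : Γ} (hB : 1 ≤ B) (s : Multiset K) (hs : ∀ w ∈ s, v w ≤ B) (i : ℕ) :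
    v ((s.map fun w => X - C w).prod.coeff i) ≤ B ^ Multiset.card s := by
  induction s using Multiset.induction_on generalizing i with
  | empty =>
    rw [Multiset.map_zero, Multiset.prod_zero, Multiset.card_zero, pow_zero, coeff_one]
    split_ifs <;> simp
  | cons w s ih =>
    have ih' := ih fun x hx => hs x (Multiset.mem_cons_of_mem hx)
    rw [Multiset.map_cons, Multiset.prod_cons, Multiset.card_cons, sub_mul, coeff_sub, coeff_C_mul]
    refine v.map_sub_le ?_ ?_
    · cases i with
      | zero => simp
      | succ i =>
        rw [coeff_X_mul]
        exact (ih' i).trans (pow_le_pow_right₀ hB (Nat.le_succ _))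
    · rw [map_mul, pow_succ']
      exact mul_le_mul' (hs w (Multiset.mem_cons_self w s)) (ih' i)

/-- Polynomials of bounded degree over a finite field form a finite set. -/
theorem finite_setOf_natDegree_le (R : Type*) [Semiring R] [Finite R] (d : ℕ) :
    {c : R[X] | c.natDegree ≤ d}.Finite := by
  refine Set.Finite.of_finite_image (f := fun c (i : Fin (d + 1)) => c.coeff i)
    (Set.toFinite _) fun x hx y hy hxy => (ext_iff_natDegree_le hx hy).2 fun i hi => ?_
  exact congr_fun hxy ⟨i, Nat.lt_succ_of_le hi⟩

section Carlitz

variable {Fq}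

theorem carlitz_eq_sum (a : Fq[X]) (u : Kbar Fq) :
    carlitz Fq a u = a.sum fun i c => c • ((carlitzT Fq ^ i) u) := by
  rw [carlitz, carlitzHom, aeval_eq_sum_range, Polynomial.sum_over_range _ (by simp)]
  simp

theorem algEquiv_carlitzT (σ : Kbar Fq ≃ₐ[RatFunc Fq] Kbar Fq) (u : Kbar Fq) :
    σ (carlitzT Fq u) = carlitzT Fq (σ u) := by
  simp [carlitzT]

theorem algEquiv_carlitz (σ : Kbar Fq ≃ₐ[RatFunc Fq] Kbar Fq) (a : Fq[X]) (u : Kbar Fq) :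
    σ (carlitz Fq a u) = carlitz Fq a (σ u) := by
  have hpow (i : ℕ) : σ ((carlitzT Fq ^ i) u) = (carlitzT Fq ^ i) (σ u) := by
    induction i with
    | zero => simp
    | succ i ih => rw [pow_succ', Module.End.mul_apply, algEquiv_carlitzT, ih,
        Module.End.mul_apply]
  have hsmul (c : Fq) (x : Kbar Fq) : σ (c • x) = c • σ x :=
    map_smul (σ.restrictScalars Fq) c x
  simp only [carlitz_eq_sum, Polynomial.sum_def, map_sum, hsmul, hpow]

variable {Γ : Type*} [LinearOrderedCommGroupWithZero Γ] (v : Valuation (Kbar Fq) Γ)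

theorem valuation_lt_valuation_carlitzT {u : Kbar Fq} (h1 : 1 < v u)
    (hT : v (algebraMap (RatFunc Fq) (Kbar Fq) RatFunc.X) < v u) : v u < v (carlitzT Fq u) := by
  have h0 : 0 < v u := zero_lt_one.trans h1
  have hq : v u * v u ≤ v u ^ Fintype.card Fq := by
    rw [← sq]
    exact pow_le_pow_right₀ h1.le Fintype.one_lt_card
  have hlt : v (algebraMap (RatFunc Fq) (Kbar Fq) RatFunc.X * u) < v (u ^ Fintype.card Fq) := by
    rw [map_mul, map_pow]
    exact (mul_lt_mul_of_pos_right hT h0).trans_le hq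
  change v u < v (algebraMap (RatFunc Fq) (Kbar Fq) RatFunc.X * u + u ^ Fintype.card Fq)
  rw [v.map_add_eq_of_lt_right hlt, map_pow]
  exact (lt_mul_of_one_lt_left h0 h1).trans_le hq

/-- Carlitz torsion points are bounded with respect to every valuation. -/
theorem valuation_le_of_carlitz_eq_zero {a : Fq[X]} (ha : a ≠ 0) {u : Kbar Fq}
    (hu : carlitz Fq a u = 0) :
    v u ≤ max 1 (v (algebraMap (RatFunc Fq) (Kbar Fq) RatFunc.X)) := by
  by_contra! h
  obtain ⟨h1, hT⟩ := max_lt_iff.1 h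
  have hle (i : ℕ) : v u ≤ v ((carlitzT Fq ^ i) u) ∧
      v ((carlitzT Fq ^ i) u) < v ((carlitzT Fq ^ (i + 1)) u) := by
    induction i with
    | zero => exact ⟨le_rfl, by simpa using valuation_lt_valuation_carlitzT v h1 hT⟩
    | succ i ih =>
      have hi := ih.1.trans ih.2.le
      refine ⟨hi, ?_⟩
      rw [pow_succ' _ (i + 1), Module.End.mul_apply]
      exact valuation_lt_valuation_carlitzT v (h1.trans_le hi) (hT.trans_le hi)
  have h0 : u ≠ 0 := v.ne_zero_iff.1 (zero_lt_one.trans h1).ne'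
  have hval := valuation_sum_coeff_smul v (f := fun i => (carlitzT Fq ^ i) u) (by simpa using h0)
    (strictMono_nat_of_lt_succ fun i => (hle i).2) ha
  rw [← carlitz_eq_sum, hu, map_zero] at hval
  exact ((zero_lt_one.trans h1).trans_le (hle a.natDegree).1).ne hval

/-- Carlitz torsion points are integral over `Fq[T]`. -/
theorem isIntegral_of_carlitz_eq_zero {a : Fq[X]} (ha : a ≠ 0) {u : Kbar Fq}
    (hu : carlitz Fq a u = 0) : IsIntegral Fq[X] u := by
  let R := (algebraMap Fq[X] (Kbar Fq)).range
  have key : u ∈ (integralClosure (Subring.closure (R : Set (Kbar Fq))) (Kbar Fq)).toSubring := by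
    rw [← iInf_valuationSubring_superset, Subring.mem_iInf]
    rintro ⟨V, hV⟩
    change u ∈ V
    rw [← V.valuation_le_one_iff]
    refine (valuation_le_of_carlitz_eq_zero V.valuation ha hu).trans (max_le le_rfl ?_)
    rw [V.valuation_le_one_iff]
    exact hV ⟨X, by rw [IsScalarTower.algebraMap_apply Fq[X] (RatFunc Fq), RatFunc.algebraMap_X]⟩
  rw [Subring.closure_eq] at key
  obtain ⟨p, hp, hpu⟩ : IsIntegral R u := key
  obtain ⟨r, rfl, -, hr⟩ := lifts_and_natDegree_eq_and_monic
    (f := (algebraMap Fq[X] (Kbar Fq)).rangeRestrict)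
    ((lifts_iff_coeff_lifts _).2 fun n => RingHom.rangeRestrict_surjective _ _) hp
  refine ⟨r, hr, ?_⟩
  rwa [eval₂_map] at hpu

end Carlitz

/-- Some valuation ring of `k̄` lies above the place at infinity of `F(T)`. -/
theorem exists_valuationSubring_one_lt_X (F : Type) [Field F] :
    ∃ V : ValuationSubring (Kbar F),
      1 < V.valuation (algebraMap (RatFunc F) (Kbar F) RatFunc.X) := by
  classical
  let O := (RatFunc.inftyValuation F).valuationSubring
  obtain ⟨V, hV, hloc⟩ := IsLocalRing.exists_factor_valuationRing
    ((algebraMap (RatFunc F) (Kbar F)).comp O.subtype)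
  refine ⟨V, ?_⟩
  by_contra! hX
  rw [V.valuation_le_one_iff] at hX
  have hmem : (RatFunc.X : RatFunc F)⁻¹ ∈ O := by
    rw [Valuation.mem_valuationSubring_iff, map_inv₀, RatFunc.inftyValuation.X,
      ← WithZero.exp_neg, ← WithZero.exp_zero, WithZero.exp_le_exp]
    norm_num
  have hunit : IsUnit (⟨RatFunc.X⁻¹, hmem⟩ : O) := by
    refine hloc.map_nonunit _ (isUnit_iff_exists_inv.2 ⟨⟨_, hX⟩, Subtype.ext ?_⟩)
    change algebraMap (RatFunc F) (Kbar F) RatFunc.X⁻¹ * algebraMap _ _ RatFunc.X = 1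
    rw [← map_mul, inv_mul_cancel₀ RatFunc.X_ne_zero, map_one]
  obtain ⟨⟨y, hy⟩, hxy⟩ := isUnit_iff_exists_inv.1 hunit
  have hxy' : (RatFunc.X : RatFunc F)⁻¹ * y = 1 := congrArg Subtype.val hxy
  rw [inv_mul_eq_one₀ RatFunc.X_ne_zero] at hxy'
  subst hxy'
  rw [Valuation.mem_valuationSubring_iff, RatFunc.inftyValuation.X, ← WithZero.exp_zero,
    WithZero.exp_le_exp] at hy
  norm_num at hy

/-- At a place above infinity the valuation of a polynomial is determined by its degree. -/
theorem valuation_algebraMap_polynomial {Γ : Type*} [LinearOrderedCommGroupWithZero Γ]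
    (v : Valuation (Kbar Fq) Γ) (hv : 1 < v (algebraMap (RatFunc Fq) (Kbar Fq) RatFunc.X))
    {c : Fq[X]} (hc : c ≠ 0) :
    v (algebraMap Fq[X] (Kbar Fq) c) =
      v (algebraMap (RatFunc Fq) (Kbar Fq) RatFunc.X) ^ c.natDegree := by
  have hX : algebraMap Fq[X] (Kbar Fq) X = algebraMap (RatFunc Fq) (Kbar Fq) RatFunc.X := by
    rw [IsScalarTower.algebraMap_apply Fq[X] (RatFunc Fq), RatFunc.algebraMap_X]
  have hsum : algebraMap Fq[X] (Kbar Fq) c =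
      c.sum fun i b => b • algebraMap (RatFunc Fq) (Kbar Fq) RatFunc.X ^ i := by
    conv_lhs => rw [c.as_sum_range]
    rw [Polynomial.sum_over_range _ (by simp), map_sum]
    refine Finset.sum_congr rfl fun i _ => ?_
    rw [← smul_X_eq_monomial, ← hX, ← map_pow]
    exact map_smul (IsScalarTower.toAlgHom Fq Fq[X] (Kbar Fq)) _ _
  rw [hsum, valuation_sum_coeff_smul v (by simp) _ hc, map_pow]
  simpa using pow_right_strictMono₀ hv

/-- The coefficients of the minimal polynomial over `Fq[T]` of a Carlitz torsion point have degree
at most the degree of that point. -/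
theorem natDegree_coeff_minpoly_le_of_carlitz_eq_zero {a : Fq[X]} (ha : a ≠ 0) {u : Kbar Fq}
    (hu : carlitz Fq a u = 0) (i : ℕ) :
    ((minpoly Fq[X] u).coeff i).natDegree ≤ (minpoly Fq[X] u).natDegree := by
  obtain ⟨V, hV⟩ := exists_valuationSubring_one_lt_X Fq
  have hint := isIntegral_of_carlitz_eq_zero ha hu
  have hmin := minpoly.isIntegrallyClosed_eq_field_fractions' (RatFunc Fq) hint
  by_cases hc : (minpoly Fq[X] u).coeff i = 0
  · simp [hc]
  let P := (minpoly Fq[X] u).map (algebraMap Fq[X] (Kbar Fq))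
  have hP : P = (minpoly (RatFunc Fq) u).map (algebraMap (RatFunc Fq) (Kbar Fq)) := by
    rw [hmin, Polynomial.map_map, ← IsScalarTower.algebraMap_eq]
  have hmonic : P.Monic := (minpoly.monic hint).map _
  have hsplit : P.Splits := IsAlgClosed.splits P
  have hroots : ∀ w ∈ P.roots,
      V.valuation w ≤ V.valuation (algebraMap (RatFunc Fq) (Kbar Fq) RatFunc.X) := by
    intro w hw
    have hw0 : aeval w (minpoly (RatFunc Fq) u) = 0 := by
      rw [hP] at hw
      rw [← eval_map_algebraMap]
      exact (mem_roots'.1 hw).2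
    have hconj : IsConjRoot (RatFunc Fq) w u :=
      (isConjRoot_of_aeval_eq_zero (Algebra.IsIntegral.isIntegral u) hw0).symm
    obtain ⟨σ, rfl⟩ := isConjRoot_iff_exists_algEquiv.1 hconj
    refine (valuation_le_of_carlitz_eq_zero V.valuation ha ?_).trans (max_le hV.le le_rfl)
    rw [← algEquiv_carlitz, hu, map_zero]
  have hcoeff := valuation_coeff_prod_X_sub_C_le V.valuation hV.le P.roots hroots i
  rw [← hsplit.eq_prod_roots_of_monic hmonic, coeff_map, valuation_algebraMap_polynomial Fq _ hV hc,
    ← hsplit.natDegree_eq_card_roots, pow_le_pow_iff_right₀ hV] at hcoeff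
  exact hcoeff.trans natDegree_map_le

set_option synthInstance.maxHeartbeats 1000000

/-- For every finite field extension `L` of `k = Fq(T)` inside `k̄`,
the Carlitz torsion `μ(L)` is a finite set. -/
theorem carlitzTorsion_finite (L : IntermediateField (RatFunc Fq) (Kbar Fq))
    [FiniteDimensional (RatFunc Fq) L] :
    (carlitzTorsion Fq L).Finite := by
  classical
  let d := Module.finrank (RatFunc Fq) L
  refine (bUnion_roots_finite (algebraMap Fq[X] (Kbar Fq)) d
    (finite_setOf_natDegree_le Fq d)).subset ?_
  rintro u ⟨huL, a, ha, hu⟩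
  have hint := isIntegral_of_carlitz_eq_zero ha hu
  have hmonic := minpoly.monic hint
  have hdeg : (minpoly Fq[X] u).natDegree ≤ d := by
    rw [← hmonic.natDegree_map (algebraMap Fq[X] (RatFunc Fq)),
      ← minpoly.isIntegrallyClosed_eq_field_fractions' (RatFunc Fq) hint]
    exact (minpoly_eq (⟨u, huL⟩ : L)).symm ▸ minpoly.natDegree_le (⟨u, huL⟩ : L)
  refine Set.mem_iUnion₂.2 ⟨minpoly Fq[X] u, ⟨hdeg, fun i =>
    (natDegree_coeff_minpoly_le_of_carlitz_eq_zero Fq ha hu i).trans hdeg⟩, ?_⟩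
  rw [Finset.mem_coe, Multiset.mem_toFinset, mem_roots (hmonic.map _).ne_zero, IsRoot.def,
    eval_map_algebraMap]
  exact minpoly.aeval _ _

end
end

section
/- Let K be a field with k ⊆ K ⊆ k̄ and let a ∈ F_q[T] be nonzero. Then K(Λ_a)/K is a finite Galois extension, it is abelian, and its Galois group Gal(K(Λ_a)/K) is isomorphic to a subgroup of the unit group (F_q[T]/(a))ˣ. -/
open Polynomial IntermediateField

noncomputable section

variable (Fq : Type) [Field Fq] [Fintype Fq]

/-- The additive polynomial representing the Carlitz action of `T ^ n`. -/
def carlitzPowPoly : ℕ → (RatFunc Fq)[X]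
  | 0 => X
  | n + 1 => C RatFunc.X * carlitzPowPoly n + carlitzPowPoly n ^ Fintype.card Fq

/-- The additive polynomial representing the Carlitz action of `a`. -/
def carlitzPoly (a : Fq[X]) : (RatFunc Fq)[X] :=
  a.sum fun n c => C (algebraMap Fq (RatFunc Fq) c) * carlitzPowPoly Fq n

lemma natDegree_carlitzPowPoly (n : ℕ) :
    (carlitzPowPoly Fq n).natDegree = Fintype.card Fq ^ n := by
  have hq : 1 < Fintype.card Fq := Fintype.one_lt_card
  induction n with
  | zero => simp [carlitzPowPoly]
  | succ n ih =>
    have hpow : (carlitzPowPoly Fq n ^ Fintype.card Fq).natDegree = Fintype.card Fq ^ (n + 1) := by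
      rw [natDegree_pow, ih, pow_succ']
    rw [carlitzPowPoly, natDegree_add_eq_right_of_natDegree_lt, hpow]
    rw [hpow, natDegree_C_mul RatFunc.X_ne_zero, ih]
    exact Nat.pow_lt_pow_right hq n.lt_succ_self

lemma natDegree_carlitzPoly {a : Fq[X]} (ha : a ≠ 0) :
    (carlitzPoly Fq a).natDegree = Fintype.card Fq ^ a.natDegree := by
  have hq : 1 < Fintype.card Fq := Fintype.one_lt_card
  have hdeg : ∀ n ∈ a.support, (C (algebraMap Fq (RatFunc Fq) (a.coeff n)) *
      carlitzPowPoly Fq n).natDegree = Fintype.card Fq ^ n := fun n hn => by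
    rw [natDegree_C_mul (by simpa using hn), natDegree_carlitzPowPoly]
  rw [carlitzPoly, Polynomial.sum, natDegree_sum_eq_of_disjoint]
  · apply le_antisymm
    · refine Finset.sup_le fun n hn => ?_
      rw [hdeg n hn]
      exact Nat.pow_le_pow_right hq.le (le_natDegree_of_mem_supp n hn)
    · have hmem := natDegree_mem_support_of_nonzero ha
      rw [← hdeg _ hmem]
      exact Finset.le_sup (f := fun n => (C (algebraMap Fq (RatFunc Fq) (a.coeff n)) *
        carlitzPowPoly Fq n).natDegree) hmem
  · rintro m ⟨hm, -⟩ n ⟨hn, -⟩ hmn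
    simp only [Function.onFun, Function.comp, hdeg m hm, hdeg n hn]
    exact fun h => hmn (Nat.pow_right_injective hq h)

lemma carlitzPoly_ne_zero {a : Fq[X]} (ha : a ≠ 0) : carlitzPoly Fq a ≠ 0 := by
  intro h
  have := natDegree_carlitzPoly Fq ha
  rw [h, natDegree_zero] at this
  exact (pow_ne_zero _ Fintype.card_ne_zero) this.symm

lemma derivative_carlitzPowPoly (n : ℕ) :
    derivative (carlitzPowPoly Fq n) = C (RatFunc.X ^ n) := by
  have hq : (Fintype.card Fq : RatFunc Fq) = 0 := by
    rw [← map_natCast (algebraMap Fq (RatFunc Fq)), FiniteField.cast_card_eq_zero, map_zero]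
  induction n with
  | zero => simp [carlitzPowPoly]
  | succ n ih => simp [carlitzPowPoly, derivative_pow, ih, hq, pow_succ']

lemma derivative_carlitzPoly (a : Fq[X]) :
    derivative (carlitzPoly Fq a) = C (algebraMap Fq[X] (RatFunc Fq) a) := by
  conv_rhs => rw [a.as_sum_support_C_mul_X_pow]
  simp [carlitzPoly, Polynomial.sum, derivative_carlitzPowPoly,
    RatFunc.algebraMap_eq_C]

lemma separable_carlitzPoly {a : Fq[X]} (ha : a ≠ 0) : (carlitzPoly Fq a).Separable := by
  rw [separable_def, derivative_carlitzPoly]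
  exact isCoprime_one_right.of_isCoprime_of_dvd_right
    (isUnit_C.2 (IsUnit.mk0 _ (by simpa using ha))).dvd

lemma aeval_carlitzPowPoly (n : ℕ) (u : Kbar Fq) :
    aeval u (carlitzPowPoly Fq n) = (carlitzT Fq ^ n) u := by
  induction n with
  | zero => simp [carlitzPowPoly]
  | succ n ih => simp [carlitzPowPoly, ih, pow_succ', carlitzT]

lemma aeval_carlitzPoly (a : Fq[X]) (u : Kbar Fq) :
    aeval u (carlitzPoly Fq a) = carlitz Fq a u := by
  rw [carlitz, carlitzHom, aeval_eq_sum_range (p := a), carlitzPoly,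
    sum_over_range _ (by simp)]
  simp only [map_sum, map_mul, aeval_C, aeval_carlitzPowPoly, LinearMap.sum_apply,
    LinearMap.smul_apply, Algebra.smul_def (R := Fq) (A := Kbar Fq),
    ← IsScalarTower.algebraMap_apply Fq (RatFunc Fq) (Kbar Fq)]

lemma Lambda_eq_rootSet {a : Fq[X]} (ha : a ≠ 0) :
    Lambda Fq a = (carlitzPoly Fq a).rootSet (Kbar Fq) := by
  ext u
  rw [mem_rootSet_of_ne (carlitzPoly_ne_zero Fq ha), aeval_carlitzPoly]
  rfl

lemma finite_Lambda {a : Fq[X]} (ha : a ≠ 0) : (Lambda Fq a).Finite := by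
  rw [Lambda_eq_rootSet Fq ha]
  exact rootSet_finite _ _

lemma ncard_Lambda {a : Fq[X]} (ha : a ≠ 0) :
    (Lambda Fq a).ncard = Fintype.card Fq ^ a.natDegree := by
  rw [Lambda_eq_rootSet Fq ha, ← natDegree_carlitzPoly Fq ha,
    ← card_rootSet_eq_natDegree (K := Kbar Fq) (separable_carlitzPoly Fq ha)
      (IsAlgClosed.splits _), ← Nat.card_coe_set_eq, Nat.card_eq_fintype_card]

lemma carlitz_mul (a b : Fq[X]) (u : Kbar Fq) :
    carlitz Fq (a * b) u = carlitz Fq a (carlitz Fq b u) := by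
  simp [carlitz]

lemma natCard_quotient_span {b : Fq[X]} (hb : b ≠ 0) :
    Nat.card (Fq[X] ⧸ Ideal.span {b}) = Fintype.card Fq ^ b.natDegree := by
  have : Module.Finite Fq (Fq[X] ⧸ Ideal.span {b}) :=
    (AdjoinRoot.powerBasis hb).finite
  rw [Module.natCard_eq_pow_finrank (K := Fq), finrank_quotient_span_eq_natDegree,
    Nat.card_eq_fintype_card]

/-- The Carlitz torsion `Λ_a` is a cyclic module whose generator has annihilator `(a)`. -/
lemma exists_Lambda_generator {a : Fq[X]} (ha : a ≠ 0) :
    ∃ u ∈ Lambda Fq a, (∀ c, carlitz Fq c u = 0 ↔ a ∣ c) ∧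
      ∀ v ∈ Lambda Fq a, ∃ c, carlitz Fq c u = v := by
  let M := Submodule.torsionBy Fq[X] (Module.AEval' (carlitzT Fq)) a
  have hsmul (c : Fq[X]) (u : Kbar Fq) : c • Module.AEval'.of (carlitzT Fq) u =
    Module.AEval'.of (carlitzT Fq) (carlitz Fq c u) := rfl
  have hM (u : Kbar Fq) : Module.AEval'.of (carlitzT Fq) u ∈ M ↔ u ∈ Lambda Fq a := by
    rw [Submodule.mem_torsionBy_iff, hsmul, LinearEquiv.map_eq_zero_iff]
    rfl
  let e : Lambda Fq a ≃ M :=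
    (Module.AEval'.of (carlitzT Fq)).toEquiv.subtypeEquiv fun u => (hM u).symm
  have hfin : Finite M := by
    have := (finite_Lambda Fq ha).to_subtype
    exact .of_equiv _ e
  have hcard : Nat.card M = Fintype.card Fq ^ a.natDegree := by
    rw [← Nat.card_congr e, Nat.card_coe_set_eq, ncard_Lambda Fq ha]
  obtain ⟨x, hx⟩ := Module.exists_ker_toSpanSingleton_eq_annihilator Fq[X] M
  obtain ⟨b, hb⟩ := IsPrincipalIdealRing.principal (Module.annihilator Fq[X] M)
  have hb' : Module.annihilator Fq[X] M = Ideal.span {b} := hb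
  have hba : b ∣ a := by
    rw [← Ideal.mem_span_singleton, ← hb', Module.mem_annihilator]
    exact fun m => Submodule.smul_torsionBy a m
  have hb0 : b ≠ 0 := ne_zero_of_dvd_ne_zero ha hba
  have hsub : Lambda Fq a ⊆ Lambda Fq b := fun u hu => by
    have hbm : b ∈ Module.annihilator Fq[X] M := hb' ▸ Ideal.mem_span_singleton_self b
    have := congrArg Subtype.val (Module.mem_annihilator.1 hbm ⟨_, (hM u).2 hu⟩)
    exact (LinearEquiv.map_eq_zero_iff (Module.AEval'.of (carlitzT Fq))).1 this
  have hle : a.natDegree ≤ b.natDegree := by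
    have := Set.ncard_le_ncard hsub (finite_Lambda Fq hb0)
    rwa [ncard_Lambda Fq ha, ncard_Lambda Fq hb0,
      Nat.pow_le_pow_iff_right Fintype.one_lt_card] at this
  have hab : Ideal.span {b} = Ideal.span {a} := by
    rw [Ideal.span_singleton_eq_span_singleton]
    exact associated_of_dvd_of_natDegree_le hba ha hle
  have hker : LinearMap.ker (LinearMap.toSpanSingleton Fq[X] M x) = Ideal.span {a} := by
    rw [hx, hb', hab]
  have hrange : Function.Surjective (LinearMap.toSpanSingleton Fq[X] M x) := by
    rw [← LinearMap.range_eq_top]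
    have h1 := Nat.card_congr (LinearMap.quotKerEquivRange (R := Fq[X]) (M := Fq[X]) (M₂ := M)
      (LinearMap.toSpanSingleton Fq[X] M x)).toEquiv
    rw [hker, natCard_quotient_span Fq ha, ← hcard] at h1
    exact SetLike.coe_injective ((Set.eq_univ_iff_ncard _).2 h1.symm)
  obtain ⟨⟨u, hu⟩, rfl⟩ := e.surjective x
  refine ⟨u, hu, fun c => ?_, fun v hv => ?_⟩
  · rw [← Ideal.mem_span_singleton, ← hker, LinearMap.mem_ker, LinearMap.toSpanSingleton_apply,
      Subtype.ext_iff]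
    exact ((Module.AEval'.of (carlitzT Fq)).map_eq_zero_iff).symm
  · obtain ⟨c, hc⟩ := hrange (e ⟨v, hv⟩)
    exact ⟨c, (Module.AEval'.of (carlitzT Fq)).injective (congrArg Subtype.val hc)⟩

lemma carlitz_algEquiv (K : IntermediateField (RatFunc Fq) (Kbar Fq))
    (L : IntermediateField K (Kbar Fq)) (σ : L ≃ₐ[K] L) (c : Fq[X]) (x y : L)
    (h : carlitz Fq c x = y) : carlitz Fq c (σ x) = σ y := by
  let P := (carlitzPoly Fq c).map (algebraMap (RatFunc Fq) K)
  have key (z : L) : carlitz Fq c z = (aeval z P : L) := by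
    rw [← aeval_carlitzPoly, ← aeval_map_algebraMap K]
    exact aeval_algebraMap_apply (Kbar Fq) z P
  rw [key] at h ⊢
  rw [← Subtype.ext h]
  exact congrArg _ (aeval_algHom_apply σ x P)

/-- For any field `k ⊆ K ⊆ k̄` and nonzero `a ∈ Fq[T]`, the extension
`K(Λ_a)/K` is finite Galois, abelian, and its Galois group is isomorphic to a subgroup
of `(Fq[T]/(a))ˣ`. -/
theorem adjoin_Lambda_galois (K : IntermediateField (RatFunc Fq) (Kbar Fq))
    (a : Polynomial Fq) (ha : a ≠ 0) :
    FiniteDimensional K (adjoin K (Lambda Fq a)) ∧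
    IsGalois K (adjoin K (Lambda Fq a)) ∧
    (∀ σ τ : adjoin K (Lambda Fq a) ≃ₐ[K] adjoin K (Lambda Fq a), σ * τ = τ * σ) ∧
    ∃ φ : (adjoin K (Lambda Fq a) ≃ₐ[K] adjoin K (Lambda Fq a)) →*
        (Polynomial Fq ⧸ Ideal.span ({a} : Set (Polynomial Fq)))ˣ,
      Function.Injective φ := by
  have hrs : Lambda Fq a =
      ((carlitzPoly Fq a).map (algebraMap (RatFunc Fq) K)).rootSet (Kbar Fq) := by
    ext u
    rw [mem_rootSet_of_ne ((Polynomial.map_ne_zero_iff (algebraMap (RatFunc Fq) K).injective).2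
      (carlitzPoly_ne_zero Fq ha)), aeval_map_algebraMap, aeval_carlitzPoly]
    rfl
  have hsplit : ((carlitzPoly Fq a).map (algebraMap (RatFunc Fq) K)).IsSplittingField K
      (adjoin K (Lambda Fq a)) := by
    rw [hrs]
    exact adjoin_rootSet_isSplittingField (IsAlgClosed.splits _)
  obtain ⟨u, hu, hann, hgen⟩ := exists_Lambda_generator Fq ha
  let L := adjoin K (Lambda Fq a)
  have hmem : ∀ v ∈ Lambda Fq a, v ∈ L := fun v hv => subset_adjoin K _ hv
  have hzero : carlitz Fq a ((⟨u, hmem u hu⟩ : L) : Kbar Fq) = ((0 : L) : Kbar Fq) := hu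
  have hσ (σ : L ≃ₐ[K] L) : ∃ c, carlitz Fq c u = σ ⟨u, hmem u hu⟩ := by
    apply hgen
    have := carlitz_algEquiv Fq K L σ a _ _ hzero
    rwa [map_zero] at this
  choose c hc using hσ
  have hmk (s t : Fq[X]) (h : carlitz Fq s u = carlitz Fq t u) :
      Ideal.Quotient.mk (Ideal.span {a}) s = Ideal.Quotient.mk (Ideal.span {a}) t := by
    rw [Ideal.Quotient.mk_eq_mk_iff_sub_mem, Ideal.mem_span_singleton, ← hann]
    simpa [carlitz, sub_eq_zero] using h
  let f : (L ≃ₐ[K] L) →* Fq[X] ⧸ Ideal.span {a} :=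
    { toFun := fun σ => Ideal.Quotient.mk _ (c σ)
      map_one' := by
        rw [← map_one (Ideal.Quotient.mk _)]
        apply hmk
        rw [hc]
        simp [carlitz]
      map_mul' := fun σ τ => by
        rw [← map_mul]
        apply hmk
        rw [hc, mul_comm, carlitz_mul, hc]
        exact (carlitz_algEquiv Fq K L σ (c τ) ⟨u, hmem u hu⟩ _ (hc τ)).symm }
  have hf : Function.Injective f := fun σ τ h => by
    have hu_eq : σ ⟨u, hmem u hu⟩ = τ ⟨u, hmem u hu⟩ := by
      apply Subtype.ext
      rw [← hc, ← hc, ← sub_eq_zero]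
      have := (hann (c σ - c τ)).2 (Ideal.mem_span_singleton.1
        ((Ideal.Quotient.mk_eq_mk_iff_sub_mem _ _).1 h))
      simpa [carlitz] using this
    apply AlgEquiv.coe_toAlgHom_injective
    refine algHom_ext_of_eq_adjoin K (S := L) rfl fun v hv => ?_
    obtain ⟨d, hd⟩ := hgen v hv
    apply Subtype.ext
    have h1 := carlitz_algEquiv Fq K L σ d ⟨u, hmem u hu⟩ ⟨v, hmem v hv⟩ hd
    have h2 := carlitz_algEquiv Fq K L τ d ⟨u, hmem u hu⟩ ⟨v, hmem v hv⟩ hd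
    rw [hu_eq] at h1
    exact h1.symm.trans h2
  refine ⟨IsSplittingField.finiteDimensional _
      ((carlitzPoly Fq a).map (algebraMap (RatFunc Fq) K)),
    IsGalois.of_separable_splitting_field
      (p := (carlitzPoly Fq a).map (algebraMap (RatFunc Fq) K)) (separable_carlitzPoly Fq ha).map,
    fun σ τ => hf ?_, f.toHomUnits, fun σ τ h => hf ?_⟩
  · rw [map_mul, map_mul, mul_comm]
  · simpa using congrArg Units.val h

end
end

section
/- Assume q > 2. For every nonzero M ∈ F_q[T], the Carlitz torsion of the cyclotomic function field k(Λ_M) is exactly Λ_M, i.e., μ(k(Λ_M)) = Λ_M. -/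
open Polynomial IntermediateField

noncomputable section

variable (Fq : Type) [Field Fq] [Fintype Fq]

namespace Carlitz

section Action

variable {F : Type*} [Field F] [Fintype F]
  {R : Type*} [CommRing R] [Algebra F R] [Algebra F[X] R]

variable (F R) in
/-- The Carlitz endomorphism `u ↦ T•u + u^q` of an arbitrary `F[T]`-algebra. -/
def actX : Module.End F R :=
  LinearMap.mulLeft F (algebraMap F[X] R X) + (FiniteField.frobeniusAlgHom F R).toLinearMap

lemma actX_apply (u : R) :
    actX F R u = algebraMap F[X] R X * u + u ^ Fintype.card F := rfl

/-- The Carlitz action of `a ∈ F[T]` on an arbitrary `F[T]`-algebra. -/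
def act (a : F[X]) : Module.End F R := aeval (actX F R) a

lemma act_X (u : R) : act (X : F[X]) u = actX F R u := by simp [act]

lemma act_C (c : F) (u : R) : act (C c) u = c • u := by
  simp [act]

lemma act_one (u : R) : act (1 : F[X]) u = u := by simp [act]

lemma act_add (a b : F[X]) (u : R) : act (a + b) u = act a u + act b u := by
  simp [act]

lemma act_mul (a b : F[X]) (u : R) : act (a * b) u = act a (act b u) := by
  simp [act]

lemma act_comm (a b : F[X]) (u : R) : act a (act b u) = act b (act a u) := by
  rw [← act_mul, mul_comm, act_mul]

variable [IsScalarTower F F[X] R]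

lemma map_act {S : Type*} [CommRing S] [Algebra F S] [Algebra F[X] S] [IsScalarTower F F[X] S]
    (f : R →ₐ[F[X]] S) (a : F[X]) (u : R) : f (act a u) = act a (f u) := by
  induction a using Polynomial.induction_on' generalizing u with
  | add p q hp hq => simp only [act_add, map_add, hp, hq]
  | monomial n c =>
    rw [← C_mul_X_pow_eq_monomial, act_mul, act_mul, act_C, act_C]
    have hc (v : R) : f (c • v) = c • f v := map_smul (f.restrictScalars F) c v
    rw [hc]
    congr 1
    induction n generalizing u with
    | zero => simp [act_one]
    | succ n ih =>
      rw [pow_succ, act_mul, act_mul, ih, act_X, act_X, actX_apply, actX_apply]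
      simp [AlgHom.commutes]

lemma exists_act_eq (a : F[X]) (u : R) :
    ∃ s, act a u = algebraMap F[X] R a * u + u ^ 2 * s := by
  induction a using Polynomial.induction_on with
  | C c =>
    refine ⟨0, ?_⟩
    rw [act_C, Algebra.smul_def, IsScalarTower.algebraMap_apply F F[X] R]
    simp
  | add p q hp hq =>
    obtain ⟨s, hs⟩ := hp
    obtain ⟨t, ht⟩ := hq
    exact ⟨s + t, by rw [act_add, hs, ht, map_add]; ring⟩
  | monomial n c ih =>
    obtain ⟨s, hs⟩ := ih
    obtain ⟨k, hk⟩ : ∃ k, Fintype.card F = k + 2 :=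
      Nat.exists_eq_add_of_le' (Fintype.one_lt_card (α := F))
    rw [show C c * X ^ (n + 1) = X * (C c * X ^ n) by ring]
    generalize C c * X ^ n = b at hs ⊢
    rw [act_mul, hs, act_X, actX_apply, hk, map_mul]
    exact ⟨algebraMap F[X] R X * s + (algebraMap F[X] R b + u * s) ^ 2 *
      (algebraMap F[X] R b * u + u ^ 2 * s) ^ k, by ring⟩

end Action

section Reduction

variable {F : Type*} [Field F] [Fintype F]

lemma frobeniusAlgHom_pow_apply {R : Type*} [CommRing R] [Algebra F R] (i : ℕ) (w : R) :
    (FiniteField.frobeniusAlgHom F R ^ i) w = w ^ Fintype.card F ^ i := by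
  rw [AlgHom.coe_pow, FiniteField.coe_frobeniusAlgHom, pow_iterate]

lemma pow_card_pow_add {R : Type*} [CommRing R] [Algebra F R] (i : ℕ) (u v : R) :
    (u + v) ^ Fintype.card F ^ i = u ^ Fintype.card F ^ i + v ^ Fintype.card F ^ i := by
  simp only [← frobeniusAlgHom_pow_apply, map_add]

/-- A monic irreducible polynomial over a finite field factors over its residue field as the
product over the Frobenius conjugates of a root. -/
lemma map_adjoinRoot_eq_prod {Q : F[X]} (hQ : Q.Monic) [Fact (Irreducible Q)] :
    Q.map (algebraMap F (AdjoinRoot Q)) =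
      ∏ i ∈ Finset.range Q.natDegree, (X - C (AdjoinRoot.root Q ^ Fintype.card F ^ i)) := by
  have hfin : Module.Finite F (AdjoinRoot Q) := hQ.finite_adjoinRoot
  have : Finite (AdjoinRoot Q) := Module.finite_of_finite F
  have hrank : Module.finrank F (AdjoinRoot Q) = Q.natDegree :=
    (AdjoinRoot.powerBasis hQ.ne_zero).finrank
  refine eq_of_monic_of_dvd_of_natDegree_le
    (monic_prod_of_monic _ _ fun i _ ↦ monic_X_sub_C _) (hQ.map _)
    (Finset.prod_dvd_of_coprime ?_ fun i _ ↦ ?_) ?_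
  · intro i hi j hj hij
    refine pairwise_coprime_X_sub_C (s := fun i : Fin Q.natDegree ↦
      AdjoinRoot.root Q ^ Fintype.card F ^ (i : ℕ)) ?_ (i := ⟨i, by simpa using hi⟩)
      (j := ⟨j, by simpa using hj⟩) (by simpa using hij)
    intro i j h
    have := FiniteField.bijective_frobeniusAlgHom_pow F (AdjoinRoot Q)
    have h2 := this.1 (a₁ := Fin.cast hrank.symm i) (a₂ := Fin.cast hrank.symm j)
      (AdjoinRoot.algHom_ext (by simpa [← frobeniusAlgHom_pow_apply] using h))
    simpa using h2
  · rw [dvd_iff_isRoot, IsRoot, eval_map_algebraMap, ← frobeniusAlgHom_pow_apply, aeval_algHom_apply,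
      AdjoinRoot.aeval_eq, AdjoinRoot.mk_self, map_zero]
  · rw [hQ.natDegree_map, natDegree_prod_of_monic _ _ fun i _ ↦ monic_X_sub_C _,
      Finset.sum_congr rfl fun i _ ↦ natDegree_X_sub_C _]
    simp

variable {R : Type*} [CommRing R] [Algebra F R] [Algebra F[X] R]

variable (F) in
/-- The evaluation of a polynomial with coefficients in `R`, written on the left, at the Carlitz
endomorphism. -/
def leftEval (u : R) : R[X] →ₗ[R] R :=
  Polynomial.lsum fun n ↦ LinearMap.toSpanSingleton R R ((actX F R ^ n) u)

lemma leftEval_monomial (u : R) (n : ℕ) (c : R) :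
    leftEval F u (monomial n c) = c * (actX F R ^ n) u := by
  simp [leftEval, lsum_apply, sum_monomial_index]

lemma leftEval_mul_X (u : R) (g : R[X]) :
    leftEval F u (g * X) = leftEval F (actX F R u) g := by
  induction g using Polynomial.induction_on' with
  | add p q hp hq => rw [add_mul, map_add, map_add, hp, hq]
  | monomial n c => rw [monomial_mul_X, leftEval_monomial, leftEval_monomial, pow_succ]; rfl

lemma leftEval_map (u : R) (a : F[X]) : leftEval F u (a.map (algebraMap F R)) = act a u := by
  induction a using Polynomial.induction_on' with
  | add p q hp hq => rw [Polynomial.map_add, map_add, act_add, hp, hq]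
  | monomial n c =>
    rw [map_monomial, leftEval_monomial, ← C_mul_X_pow_eq_monomial, act_mul, act_C,
      Algebra.smul_def]
    simp [act]

lemma leftEval_prod (u : R) (d : ℕ) :
    leftEval F u (∏ i ∈ Finset.range d, (X - C (algebraMap F[X] R X ^ Fintype.card F ^ i))) =
      u ^ Fintype.card F ^ d := by
  induction d generalizing u with
  | zero => 
    have := leftEval_monomial (F := F) u 0 1
    simpa using this
  | succ d ih =>
    rw [Finset.prod_range_succ, mul_sub, map_sub, leftEval_mul_X, ih, mul_comm _ (C _),
      ← smul_eq_C_mul, map_smul, ih, actX_apply, pow_card_pow_add, mul_pow, smul_eq_mul,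
      ← pow_mul, ← pow_succ']
    ring

variable [IsScalarTower F F[X] R]

/-- In characteristic `Q`, the Carlitz action of `Q` is the `q ^ deg Q`-power map. -/
lemma act_eq_pow {Q : F[X]} (hQ : Q.Monic) (hQ' : Irreducible Q)
    (h0 : algebraMap F[X] R Q = 0) (u : R) :
    act Q u = u ^ Fintype.card F ^ Q.natDegree := by
  have : Fact (Irreducible Q) := ⟨hQ'⟩
  have hroot : aeval (algebraMap F[X] R X) Q = 0 := by
    rw [aeval_algebraMap_apply, aeval_X_left_apply, h0]
  obtain ⟨ψ, hψ⟩ : ∃ ψ : AdjoinRoot Q →ₐ[F] R, ψ (AdjoinRoot.root Q) = algebraMap F[X] R X :=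
    ⟨AdjoinRoot.liftAlgHom Q (Algebra.ofId F R) _ hroot, AdjoinRoot.liftAlgHom_root ..⟩
  have h := congrArg (Polynomial.map (ψ : AdjoinRoot Q →+* R)) (map_adjoinRoot_eq_prod hQ)
  rw [Polynomial.map_map, AlgHom.comp_algebraMap, Polynomial.map_prod] at h
  rw [← leftEval_map, h, ← leftEval_prod]
  simp [hψ]

end Reduction

section Polynomial

variable {F : Type*} [Field F] [Fintype F]

lemma derivative_actX (f : F[X][X]) :
    derivative (actX F F[X][X] f) = C X * derivative f := by
  have h : ((Fintype.card F : ℕ) : F[X]) = 0 := by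
    rw [← C_eq_natCast, FiniteField.cast_card_eq_zero, C_0]
  rw [actX_apply, derivative_add, derivative_pow, algebraMap_eq, derivative_C_mul, h]
  simp

lemma derivative_act (a : F[X]) (f : F[X][X]) :
    derivative (act a f) = C a * derivative f := by
  induction a using Polynomial.induction_on generalizing f with
  | C c =>
    rw [act_C, derivative_smul, Algebra.smul_def, IsScalarTower.algebraMap_apply F F[X] F[X][X]]
    simp
  | add p q hp hq => rw [act_add, derivative_add, hp, hq, C_add, add_mul]
  | monomial n c ih =>
    rw [pow_succ, ← mul_assoc, act_mul, ih, act_X, derivative_actX, C_mul (a := C c * X ^ n)]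
    ring

lemma monic_act_X_pow (n : ℕ) :
    (act (X ^ n : F[X]) (X : F[X][X])).Monic ∧
      (act (X ^ n : F[X]) (X : F[X][X])).natDegree = Fintype.card F ^ n := by
  have hq : 1 < Fintype.card F := Fintype.one_lt_card
  induction n with
  | zero => simp [act_one, monic_X]
  | succ n ih =>
    obtain ⟨hm, hd⟩ := ih
    have hdp := hm.natDegree_pow (Fintype.card F)
    have hlt : (algebraMap F[X] F[X][X] X * act (X ^ n : F[X]) (X : F[X][X])).degree <
        ((act (X ^ n : F[X]) (X : F[X][X])) ^ Fintype.card F).degree := by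
      rw [algebraMap_eq, degree_C_mul X_ne_zero, degree_eq_natDegree hm.ne_zero,
        degree_eq_natDegree (hm.pow _).ne_zero, hdp, hd]
      exact_mod_cast lt_mul_of_one_lt_left (by positivity) hq
    rw [pow_succ', act_mul, act_X, actX_apply]
    refine ⟨(hm.pow _).add_of_right hlt, ?_⟩
    rw [natDegree_add_eq_right_of_degree_lt hlt, hdp, hd, pow_succ']

lemma monic_act_X {a : F[X]} (ha : a.Monic) : (act a (X : F[X][X])).Monic := by
  have hq : 1 < Fintype.card F := Fintype.one_lt_card
  obtain ⟨hm, hd⟩ := monic_act_X_pow (F := F) a.natDegree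
  rw [ha.as_sum, act_add]
  refine hm.add_of_left ?_
  rw [degree_eq_natDegree hm.ne_zero, hd]
  have hsum : act (∑ i ∈ Finset.range a.natDegree, C (a.coeff i) * X ^ i) (X : F[X][X]) =
      ∑ i ∈ Finset.range a.natDegree, a.coeff i • act (X ^ i : F[X]) (X : F[X][X]) := by
    simp only [← act_C, ← act_mul]
    simp [act]
  rw [hsum]
  refine (degree_sum_le _ _).trans_lt ((Finset.sup_lt_iff (WithBot.bot_lt_coe _)).mpr ?_)
  intro i hi
  refine (degree_smul_le _ _).trans_lt ?_
  obtain ⟨hmi, hdi⟩ := monic_act_X_pow (F := F) i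
  rw [degree_eq_natDegree hmi.ne_zero, hdi]
  exact_mod_cast Nat.pow_lt_pow_right hq (Finset.mem_range.mp hi)

variable {R : Type*} [CommRing R] [Algebra F R] [Algebra F[X] R] [IsScalarTower F F[X] R]

lemma aeval_act_X (a : F[X]) (u : R) : aeval u (act a (X : F[X][X])) = act a u := by
  rw [map_act, aeval_X]

lemma isIntegral_of_act_eq_zero {a : F[X]} (ha : a ≠ 0) {u : R} (hu : act a u = 0) :
    IsIntegral F[X] u := by
  refine ⟨_, monic_act_X (monic_mul_leadingCoeff_inv ha), ?_⟩
  rw [← aeval_def, aeval_act_X, mul_comm, act_mul, hu, map_zero]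

end Polynomial

section Frobenius

variable {F : Type*} [Field F] [Fintype F]
  {K E : Type*} [Field K] [Field E] [Algebra F[X] K] [IsFractionRing F[X] K] [Algebra K E]
  [Algebra F[X] E] [IsScalarTower F[X] K E] [Algebra F E] [IsScalarTower F F[X] E]
  [FiniteDimensional K E] [IsGalois K E]

variable (K) in
/-- A Frobenius element at a prime `Q` not dividing `L` acts on the `L`-torsion as the Carlitz
action of `Q`. -/
lemma exists_frobenius {Q L : F[X]} (hQ : Q.Monic) (hQ' : Irreducible Q) (hL : ¬ Q ∣ L) :
    ∃ σ : Gal(E/K), ∀ u : E, act L u = 0 → σ u = act Q u := by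
  have hL0 : L ≠ 0 := by rintro rfl; exact hL (dvd_zero _)
  let B := integralClosure F[X] E
  have : IsScalarTower F F[X] B := .of_algebraMap_eq fun x ↦ Subtype.ext
    (IsScalarTower.algebraMap_apply F F[X] E x)
  have hfin : Module.Finite F[X] B := IsIntegralClosure.finite F[X] K E B
  have : IsFractionRing B E := integralClosure.isFractionRing_of_finite_extension K E
  let _ := IsIntegralClosure.MulSemiringAction F[X] K E B
  have : Algebra.IsInvariant F[X] B Gal(E/K) := Algebra.isInvariant_of_isGalois F[X] K E B
  have : SMulCommClass Gal(E/K) F[X] B :=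
    ⟨fun σ a b ↦ map_smul (galRestrict F[X] K E B σ) a b⟩
  have hmax : (Ideal.span {Q}).IsMaximal :=
    PrincipalIdealRing.isMaximal_of_irreducible hQ'
  have : FaithfulSMul F[X] E := (faithfulSMul_iff_algebraMap_injective _ _).mpr <| by
    rw [IsScalarTower.algebraMap_eq F[X] K E]
    exact (algebraMap K E).injective.comp (IsFractionRing.injective F[X] K)
  obtain ⟨P, hP, hPQ⟩ := Ideal.exists_maximal_ideal_liesOver_of_isIntegral (S := B)
    (Ideal.span {Q})
  have hunder : P.under F[X] = Ideal.span {Q} := hPQ.over.symm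
  have hmod : Module.Finite F (F[X] ⧸ Ideal.span {Q}) := hQ.finite_adjoinRoot
  have : Finite (F[X] ⧸ Ideal.span {Q}) := Module.finite_of_finite F
  have : Module.Finite (F[X] ⧸ Ideal.span {Q}) (B ⧸ P) := inferInstance
  have : Finite (B ⧸ P) := Module.finite_of_finite (F[X] ⧸ Ideal.span {Q})
  have hcard : Nat.card (F[X] ⧸ P.under F[X]) = Fintype.card F ^ Q.natDegree := by
    rw [hunder, Module.natCard_eq_pow_finrank (K := F), Nat.card_eq_fintype_card]
    congr 1
    exact (AdjoinRoot.powerBasis hQ.ne_zero).finrank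
  obtain ⟨σ, hσ⟩ := IsArithFrobAt.exists_of_isInvariant F[X] Gal(E/K) P
  refine ⟨σ, fun u hu ↦ ?_⟩
  obtain ⟨v, rfl⟩ : ∃ v : B, algebraMap B E v = u :=
    ⟨⟨u, isIntegral_of_act_eq_zero hL0 hu⟩, rfl⟩
  have hcoe (a : F[X]) (w : B) : algebraMap B E (act a w) = act a (algebraMap B E w) :=
    map_act (IsScalarTower.toAlgHom F[X] B E) a w
  have hinj : Function.Injective (algebraMap B E) := FaithfulSMul.algebraMap_injective B E
  have hv : act L v = 0 := hinj (by rw [hcoe, hu, map_zero])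
  have hσv : algebraMap B E (σ • v) = σ (algebraMap B E v) :=
    algebraMap_galRestrict_apply F[X] σ v
  have hsmul (a : F[X]) (w : B) : act a (σ • w) = σ • act a w :=
    (map_act (MulSemiringAction.toAlgHom F[X] B σ) a w).symm
  rw [← hσv, ← hcoe]
  congr 1
  rw [← sub_eq_zero]
  by_contra hne
  have hmem : σ • v - act Q v ∈ P := by
    have h0 : algebraMap F[X] (B ⧸ P) Q = 0 := by
      rw [IsScalarTower.algebraMap_apply F[X] B (B ⧸ P)]
      refine Ideal.Quotient.eq_zero_iff_mem.mpr ?_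
      change Q ∈ P.under F[X]
      rw [hunder]
      exact Ideal.mem_span_singleton_self Q
    have h1 := act_eq_pow hQ hQ' h0 (Ideal.Quotient.mk P v)
    have h2 : Ideal.Quotient.mk P (act Q v) = act Q (Ideal.Quotient.mk P v) :=
      map_act (Ideal.Quotient.mkₐ F[X] P) Q v
    have h3 := hσ v
    rw [hcard] at h3
    rw [← Ideal.Quotient.eq_zero_iff_mem] at h3 ⊢
    rw [map_sub, h2, h1, ← map_pow, ← map_sub]
    exact h3
  obtain ⟨s, hs⟩ := exists_act_eq (R := B) L (σ • v - act Q v)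
  rw [map_sub, hsmul, act_comm, hv, smul_zero, map_zero, sub_zero] at hs
  have hs' : algebraMap F[X] B L + (σ • v - act Q v) * s = 0 :=
    (mul_eq_zero.mp (show (σ • v - act Q v) * _ = 0 by rw [hs]; ring)).resolve_left hne
  apply hL
  rw [← Ideal.mem_span_singleton, ← hunder]
  change algebraMap F[X] B L ∈ P
  rw [eq_neg_of_add_eq_zero_left hs']
  exact P.neg_mem (P.mul_mem_right _ hmem)

variable (K) in
/-- Every monic polynomial prime to `L` acts on the `L`-torsion as a Galois automorphism. -/
lemma exists_gal_normalize [DecidableEq F] {a L : F[X]} (ha : IsCoprime a L) (ha0 : a ≠ 0) :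
    ∃ σ : Gal(E/K), ∀ u : E, act L u = 0 → σ u = act (normalize a) u := by
  induction a using UniqueFactorizationMonoid.induction_on_prime with
  | h₁ => exact absurd rfl ha0
  | h₂ x hx => exact ⟨1, fun u _ ↦ by rw [normalize_eq_one.mpr hx, act_one]; rfl⟩
  | h₃ a p ha0' hp ih =>
    obtain ⟨σ, hσ⟩ := ih ha.of_mul_left_right ha0'
    obtain ⟨τ, hτ⟩ := exists_frobenius K (E := E) (Q := normalize p) (L := L)
      (monic_normalize hp.ne_zero) ((normalize_associated p).irreducible_iff.mpr hp.irreducible)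
      (fun h ↦ hp.not_isUnit (ha.of_mul_left_left.isUnit_of_dvd' dvd_rfl
        ((normalize_associated p).dvd_iff_dvd_left.mp h)))
    refine ⟨τ * σ, fun u hu ↦ ?_⟩
    have hσu : act L (σ u) = 0 := by rw [hσ u hu, act_comm, hu, map_zero]
    rw [AlgEquiv.mul_apply, hτ _ hσu, hσ u hu, normalize_mul, act_mul]

end Frobenius

section Torsion

variable {F : Type*} [Field F] [Fintype F]

lemma exists_not_dvd_one_add_C_mul (hq : 2 < Fintype.card F) (M : F[X]) {P : F[X]}
    (hP : Irreducible P) : ∃ b : F, b ≠ 0 ∧ ¬ P ∣ 1 + C b * M := by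
  classical
  obtain ⟨c, hc⟩ : ∃ c : F, c ∉ ({0, 1} : Finset F) := by
    by_contra! h
    have := Finset.card_le_card (fun x _ ↦ h x : Finset.univ ⊆ ({0, 1} : Finset F))
    rw [Finset.card_univ] at this
    exact absurd (this.trans Finset.card_le_two) (by omega)
  simp only [Finset.mem_insert, Finset.mem_singleton, not_or] at hc
  by_contra! h
  have h1 := h 1 one_ne_zero
  have hc' := h c hc.1
  have h2 : P ∣ C (1 - c) * M := by
    convert dvd_sub h1 hc' using 1
    rw [C_sub]
    ring
  have h3 : P ∣ M := by
    have hu : IsUnit (C (1 - c)) := isUnit_C.mpr (sub_ne_zero.mpr (Ne.symm hc.2)).isUnit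
    exact hu.dvd_mul_left.mp h2
  exact hP.not_isUnit (isUnit_of_dvd_one ((dvd_add_left (h3.mul_left _)).mp h1))

variable {K E : Type*} [Field K] [Field E] [Algebra F[X] K] [IsFractionRing F[X] K] [Algebra K E]
  [Algebra F[X] E] [IsScalarTower F[X] K E] [Algebra F E] [IsScalarTower F F[X] E]
  [FiniteDimensional K E] [IsGalois K E]

variable (K) in
/-- Every polynomial prime to `L` acts on the `L`-torsion as a Galois automorphism. -/
lemma exists_gal_act {a L : F[X]} (ha : IsCoprime a L) (hL : L ≠ 0) :
    ∃ σ : Gal(E/K), ∀ u : E, act L u = 0 → σ u = act a u := by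
  classical
  set m := L * C L.leadingCoeff⁻¹ * X ^ (a.natDegree + 1)
  have hmL : (L * C L.leadingCoeff⁻¹).Monic := monic_mul_leadingCoeff_inv hL
  have hm : m.Monic := hmL.mul (monic_X_pow _)
  have hlt : a.degree < m.degree := by
    refine degree_lt_degree (Nat.lt_succ_self _ |>.trans_le ?_)
    rw [hmL.natDegree_mul (monic_X_pow _), natDegree_X_pow]
    omega
  have hmon : (a + m).Monic := hm.add_of_right hlt
  have hcop : IsCoprime (a + m) L := by
    have : a + m = a + L * (C L.leadingCoeff⁻¹ * X ^ (a.natDegree + 1)) := by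
      simp only [m]; ring
    rw [this]
    exact ha.add_mul_left_left _
  obtain ⟨σ, hσ⟩ := exists_gal_normalize K (E := E) hcop hmon.ne_zero
  refine ⟨σ, fun u hu ↦ ?_⟩
  rw [hσ u hu, hmon.normalize_eq_self, act_add]
  simp only [m]
  rw [mul_assoc, mul_comm, act_mul, hu, map_zero, add_zero]

variable (K) in
lemma act_eq_zero_of_act_irreducible_mul (hq : 2 < Fintype.card F) {M : F[X]} (hM : M ≠ 0)
    (hE : ∀ σ : Gal(E/K), (∀ u, act M u = 0 → σ u = u) → σ = 1)
    {P : F[X]} (hP : Irreducible P) {v : E} (hv : act (P * M) v = 0) : act M v = 0 := by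
  obtain ⟨b, hb, hPb⟩ := exists_not_dvd_one_add_C_mul hq M hP
  have hcop : IsCoprime (1 + C b * M) (P * M) := by
    refine .mul_right (hP.coprime_iff_not_dvd.mpr hPb).symm ?_
    exact ⟨1, -C b, by ring⟩
  obtain ⟨σ, hσ⟩ := exists_gal_act K (E := E) hcop (mul_ne_zero hP.ne_zero hM)
  have hact (u : E) : act (1 + C b * M) u = u + b • act M u := by
    rw [act_add, act_one, act_mul, act_C]
  have h1 : σ = 1 := hE σ fun u hu ↦ by
    rw [hσ u (by rw [act_mul, hu, map_zero]), hact, hu, smul_zero, add_zero]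
  have h2 := hσ v hv
  rw [h1, hact, AlgEquiv.one_apply, left_eq_add] at h2
  exact (smul_eq_zero.mp h2).resolve_left hb

variable (K) in
/-- If `E` is generated by the `M`-torsion and `q > 2`, then torsion points in `E` killed by a
nonzero multiple of `M` are already killed by `M`. -/
lemma act_eq_zero_of_act_mul (hq : 2 < Fintype.card F) {M : F[X]} (hM : M ≠ 0)
    (hE : ∀ σ : Gal(E/K), (∀ u, act M u = 0 → σ u = u) → σ = 1)
    {a : F[X]} (ha : a ≠ 0) {v : E} (hv : act (a * M) v = 0) : act M v = 0 := by
  induction a using WfDvdMonoid.induction_on_irreducible generalizing v with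
  | zero => exact absurd rfl ha
  | unit x hx =>
    obtain ⟨y, hy⟩ := hx.exists_left_inv
    rw [← act_one (F := F) (act M v), ← hy, act_mul, ← act_mul x, hv, map_zero]
  | mul a P ha' hP ih =>
    refine ih ha' ?_
    rw [act_mul, act_comm]
    refine act_eq_zero_of_act_irreducible_mul K hq hM hE hP ?_
    rw [← hv, ← act_mul]
    ring_nf

end Torsion

section Cyclotomic

variable {F : Type} [Field F] [Fintype F]

lemma carlitz_eq_act (a : F[X]) (u : Kbar F) : carlitz F a u = act a u := by
  have : carlitzT F = actX F (Kbar F) := by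
    ext u
    change algebraMap (RatFunc F) (Kbar F) RatFunc.X * u + _ = _
    rw [actX_apply, IsScalarTower.algebraMap_apply F[X] (RatFunc F) (Kbar F),
      RatFunc.algebraMap_X]
  rw [carlitz, carlitzHom, this, act]

variable (F) in
/-- The polynomial over `F(T)` whose roots are the `M`-torsion points of the Carlitz module. -/
abbrev torsionPoly (M : F[X]) : (RatFunc F)[X] :=
  (act M (X : F[X][X])).map (algebraMap F[X] (RatFunc F))

lemma separable_torsionPoly {M : F[X]} (hM : M ≠ 0) : (torsionPoly F M).Separable := by
  have hu : IsUnit (derivative (torsionPoly F M)) := by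
    rw [derivative_map, derivative_act, derivative_X, mul_one, map_C, isUnit_C,
      isUnit_iff_ne_zero]
    exact (map_ne_zero_iff _ (RatFunc.algebraMap_injective F)).mpr hM
  obtain ⟨w, hw⟩ := hu.exists_left_inv
  exact ⟨0, w, by rw [zero_mul, zero_add, hw]⟩

lemma rootSet_torsionPoly {M : F[X]} (hM : M ≠ 0) :
    (torsionPoly F M).rootSet (Kbar F) = Lambda F M := by
  ext u
  rw [mem_rootSet_of_ne (separable_torsionPoly hM).ne_zero, aeval_map_algebraMap, aeval_act_X,
    ← carlitz_eq_act]
  rfl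

end Cyclotomic
end Carlitz

/-- Assume `q > 2`.  For every nonzero `M ∈ Fq[T]`, the Carlitz torsion
of the cyclotomic function field `k(Λ_M)` is exactly `Λ_M`. -/
theorem carlitzTorsion_cyclotomic (hq : 2 < Fintype.card Fq)
    (M : Polynomial Fq) (hM : M ≠ 0) :
    carlitzTorsion Fq (adjoin (RatFunc Fq) (Lambda Fq M)) = Lambda Fq M := by
  set E := adjoin (RatFunc Fq) (Lambda Fq M) with hE
  have hsplit : (Carlitz.torsionPoly Fq M).IsSplittingField (RatFunc Fq) E := by
    rw [hE, ← Carlitz.rootSet_torsionPoly hM]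
    exact adjoin_rootSet_isSplittingField (IsAlgClosed.splits _)
  have : FiniteDimensional (RatFunc Fq) E :=
    Polynomial.IsSplittingField.finiteDimensional E (Carlitz.torsionPoly Fq M)
  have : IsGalois (RatFunc Fq) E :=
    .of_separable_splitting_field (Carlitz.separable_torsionPoly hM)
  have : IsScalarTower Fq Fq[X] E := .of_algebraMap_eq fun x ↦ Subtype.ext
    (IsScalarTower.algebraMap_apply Fq Fq[X] (Kbar Fq) x)
  have : IsScalarTower Fq[X] E (Kbar Fq) := .of_algebraMap_eq fun _ ↦ rfl
  have hcoe (a : Fq[X]) (w : E) : (Carlitz.act a w : E) = carlitz Fq a (w : Kbar Fq) := by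
    rw [Carlitz.carlitz_eq_act]
    exact Carlitz.map_act (IsScalarTower.toAlgHom Fq[X] E (Kbar Fq)) a w
  have hgal (σ : Gal(E/RatFunc Fq)) (h : ∀ u : E, Carlitz.act M u = 0 → σ u = u) : σ = 1 := by
    refine AlgEquiv.coe_toAlgHom_injective (adjoin_algHom_ext _ fun x hx ↦ ?_)
    refine h _ (Subtype.ext ?_)
    rw [hcoe]
    exact hx
  ext u
  refine ⟨?_, fun hu ↦ ⟨subset_adjoin _ _ hu, M, hM, hu⟩⟩
  rintro ⟨huE, a, ha, hau⟩
  have hv : Carlitz.act (a * M) (⟨u, huE⟩ : E) = 0 := by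
    refine Subtype.ext ?_
    rw [hcoe, mul_comm, carlitz, map_mul]
    change carlitzHom Fq M (carlitz Fq a u) = 0
    rw [hau, map_zero]
  have := Carlitz.act_eq_zero_of_act_mul (RatFunc Fq) hq hM hgal ha hv
  rw [Subtype.ext_iff, hcoe] at this
  exact this

end
end

section
/- Let K be a field with k ⊆ K ⊆ k̄, let α, β ∈ k̄ and L = K(α, β). Suppose there exist m, n ∈ F_q[T] with C_m(α) ∈ K, C_n(β) ∈ K and (m) + (n) = F_q[T] (m and n relatively prime). Then L = K(α + β), and moreover C_{mn}(α + β) ∈ K, so α + β ∈ DrinT(L/K). -/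
open Polynomial IntermediateField

noncomputable section

variable (Fq : Type) [Field Fq] [Fintype Fq]

/-- The Carlitz action preserves every intermediate field of `k̄/k`. -/
theorem carlitz_mem (F : IntermediateField (RatFunc Fq) (Kbar Fq)) (a : Polynomial Fq)
    {u : Kbar Fq} (hu : u ∈ F) : carlitz Fq a u ∈ F := by
  induction a using Polynomial.induction_on generalizing u with
  | C c =>
    have h : carlitz Fq (Polynomial.C c) u = algebraMap (RatFunc Fq) (Kbar Fq)
        (algebraMap Fq (RatFunc Fq) c) * u := by
      rw [← IsScalarTower.algebraMap_apply Fq (RatFunc Fq) (Kbar Fq), carlitz, carlitzHom,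
        aeval_C, Module.algebraMap_end_apply, Algebra.smul_def]
    rw [h]
    exact mul_mem (F.algebraMap_mem _) hu
  | add f g hf hg =>
    have h : carlitz Fq (f + g) u = carlitz Fq f u + carlitz Fq g u := by simp [carlitz]
    rw [h]
    exact add_mem (hf hu) (hg hu)
  | monomial n c ih =>
    have h : carlitz Fq (Polynomial.C c * X ^ (n + 1)) u =
        carlitz Fq (Polynomial.C c * X ^ n) (carlitzT Fq u) := by
      simp [carlitz, carlitzHom, pow_succ]
    rw [h]
    exact ih (add_mem (mul_mem (F.algebraMap_mem _) hu) (pow_mem hu _))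

theorem carlitz_mul_apply (a b : Polynomial Fq) (u : Kbar Fq) :
    carlitz Fq (a * b) u = carlitz Fq a (carlitz Fq b u) := by
  simp [carlitz]

theorem carlitz_apply_add (a : Polynomial Fq) (u v : Kbar Fq) :
    carlitz Fq a (u + v) = carlitz Fq a u + carlitz Fq a v := by
  simp [carlitz]

/-- An element sent into an intermediate field by two coprime polynomials lies in it. -/
theorem mem_of_isCoprime_of_carlitz_mem (F : IntermediateField (RatFunc Fq) (Kbar Fq))
    {m n : Polynomial Fq} (hcop : IsCoprime m n) {u : Kbar Fq}
    (hm : carlitz Fq m u ∈ F) (hn : carlitz Fq n u ∈ F) : u ∈ F := by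
  obtain ⟨a, b, hab⟩ := hcop
  have h : u = carlitz Fq a (carlitz Fq m u) + carlitz Fq b (carlitz Fq n u) := by
    rw [← carlitz_mul_apply, ← carlitz_mul_apply]
    calc u = carlitz Fq (a * m + b * n) u := by rw [hab]; simp [carlitz]
      _ = _ := by simp only [carlitz, map_add, LinearMap.add_apply]
  rw [h]
  exact add_mem (carlitz_mem Fq F a hm) (carlitz_mem Fq F b hn)

/-- If `L = K(α, β)` with `C_m(α) ∈ K`, `C_n(β) ∈ K` for relatively
prime nonzero `m, n ∈ Fq[T]`, then `L = K(α + β)`; moreover `C_{mn}(α + β) ∈ K`, so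
`α + β ∈ DrinT(L/K)`. -/
theorem primitive_element_of_coprime_orders (K : IntermediateField (RatFunc Fq) (Kbar Fq))
    (α β : Kbar Fq) (m n : Polynomial Fq) (hm0 : m ≠ 0) (hn0 : n ≠ 0)
    (hm : carlitz Fq m α ∈ K) (hn : carlitz Fq n β ∈ K) (hcop : IsCoprime m n) :
    adjoin (RatFunc Fq) ((K : Set (Kbar Fq)) ∪ {α, β}) =
      adjoin (RatFunc Fq) ((K : Set (Kbar Fq)) ∪ {α + β}) ∧
    carlitz Fq (m * n) (α + β) ∈ K ∧
    α + β ∈ DrinT Fq K (adjoin (RatFunc Fq) ((K : Set (Kbar Fq)) ∪ {α, β})) := by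
  set L := adjoin (RatFunc Fq) ((K : Set (Kbar Fq)) ∪ {α, β}) with hL
  set M := adjoin (RatFunc Fq) ((K : Set (Kbar Fq)) ∪ {α + β}) with hM
  have hKL : ∀ u ∈ K, u ∈ L := fun u hu => subset_adjoin _ _ (Or.inl hu)
  have hKM : ∀ u ∈ K, u ∈ M := fun u hu => subset_adjoin _ _ (Or.inl hu)
  have hγL : α + β ∈ L :=
    add_mem (subset_adjoin _ _ (by simp)) (subset_adjoin _ _ (by simp))
  have hγM : α + β ∈ M := subset_adjoin _ _ (by simp)
  have hβ : β ∈ M := by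
    refine mem_of_isCoprime_of_carlitz_mem Fq M hcop ?_ (hKM _ hn)
    rw [← add_sub_cancel_left (carlitz Fq m α) (carlitz Fq m β), ← carlitz_apply_add]
    exact sub_mem (carlitz_mem Fq M m hγM) (hKM _ hm)
  have hα : α ∈ M := by simpa using sub_mem hγM hβ
  have hmn : carlitz Fq (m * n) (α + β) ∈ K := by
    rw [carlitz_apply_add, carlitz_mul_apply Fq m n β, mul_comm, carlitz_mul_apply]
    exact add_mem (carlitz_mem Fq K n hm) (carlitz_mem Fq K m hn)
  refine ⟨le_antisymm (adjoin_le_iff.2 ?_) (adjoin_le_iff.2 ?_), hmn,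
    hγL, m * n, mul_ne_zero hm0 hn0, hmn⟩
  · rintro u (hu | rfl | rfl)
    exacts [hKM u hu, hα, hβ]
  · rintro u (hu | rfl)
    exacts [hKL u hu, hγL]

end
end

section
/- Let k ⊆ E ⊆ L ⊆ L' ⊆ k̄ be a tower of fields. Then: (i) if L'/E is cyclotomic coradical, then L'/L is cyclotomic coradical; (ii) if L'/E is radical and both L'/L and L/E are cyclotomic coradical, then L'/E is cyclotomic coradical. -/
open Polynomial IntermediateField

noncomputable section

variable (Fq : Type) [Field Fq] [Fintype Fq]

variable {Fq}

lemma IsRadicalC.tower_top {E L L' : IntermediateField (RatFunc Fq) (Kbar Fq)}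
    (hEL : E ≤ L) (hLL' : L ≤ L') (h : IsRadicalC Fq E L') : IsRadicalC Fq L L' := by
  obtain ⟨X, hX, hL'⟩ := h
  refine ⟨X, fun u hu ↦ ?_, le_antisymm ?_ ?_⟩
  · obtain ⟨huL', m, hm, hmu⟩ := hX hu
    exact ⟨huL', m, hm, hEL hmu⟩
  · rw [hL']
    exact adjoin.mono _ _ _ (Set.union_subset_union_left X hEL)
  · exact adjoin_le_iff.2 (Set.union_subset hLL' fun u hu ↦ (hX hu).1)

lemma IsSeparableC.tower_top {E L L' : IntermediateField (RatFunc Fq) (Kbar Fq)}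
    (hEL : E ≤ L) (h : IsSeparableC Fq E L') : IsSeparableC Fq L L' := by
  intro u hu
  let := (inclusion hEL).toAlgebra
  have : IsScalarTower E L (Kbar Fq) := .of_algebraMap_eq fun _ ↦ rfl
  exact (h u hu).tower_top L

lemma IsSeparableC.trans {E L L' : IntermediateField (RatFunc Fq) (Kbar Fq)}
    (hEL : E ≤ L) (h : IsSeparableC Fq E L) (h' : IsSeparableC Fq L L') :
    IsSeparableC Fq E L' := by
  intro u hu
  let := (inclusion hEL).toAlgebra
  have : IsScalarTower E L (Kbar Fq) := .of_algebraMap_eq fun _ ↦ rfl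
  have : Algebra.IsSeparable E L :=
    ⟨fun x ↦ (isSeparable_map_iff (IsScalarTower.toAlgHom E L (Kbar Fq))
      (algebraMap L (Kbar Fq)).injective).1 (h x x.2)⟩
  exact .of_algebra_isSeparable_of_isSeparable E (h' u hu)

lemma IsPureC.tower_top {E L L' : IntermediateField (RatFunc Fq) (Kbar Fq)}
    (hEL : E ≤ L) (h : IsPureC Fq E L') : IsPureC Fq L L' :=
  fun m hm u hu hmu ↦ hEL (h m hm u hu hmu)

lemma IsPureC.trans {E L L' : IntermediateField (RatFunc Fq) (Kbar Fq)}
    (h : IsPureC Fq E L) (h' : IsPureC Fq L L') : IsPureC Fq E L' :=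
  fun m hm u hu hmu ↦ h m hm u (h' m hm u hu hmu) hmu

variable (Fq)

/-- For a tower `k ⊆ E ⊆ L ⊆ L' ⊆ k̄`: (i) if `L'/E` is cyclotomic
coradical then so is `L'/L`; (ii) if `L'/E` is radical and both `L'/L` and `L/E` are
cyclotomic coradical, then `L'/E` is cyclotomic coradical. -/
theorem isCycloCoradical_tower (E L L' : IntermediateField (RatFunc Fq) (Kbar Fq))
    (hEL : E ≤ L) (hLL' : L ≤ L') :
    (IsCycloCoradicalC Fq E L' → IsCycloCoradicalC Fq L L') ∧
    (IsRadicalC Fq E L' → IsCycloCoradicalC Fq L L' → IsCycloCoradicalC Fq E L →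
      IsCycloCoradicalC Fq E L') := by
  refine ⟨fun ⟨hr, hs, hp⟩ ↦ ⟨hr.tower_top hEL hLL', hs.tower_top hEL, hp.tower_top hEL⟩, ?_⟩
  rintro hr ⟨-, hs', hp'⟩ ⟨-, hs, hp⟩
  exact ⟨hr, hs.trans hEL hs', hp.trans hp'⟩

end
end
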